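/- Let M, N be weight sequences satisfying m_k^{1/k}→∞ and n_k^{1/k}→∞, with C := mg(M,N) < ∞, and let ε>0. Let g be holomorphic on Ω_ε and continuous on its closure, and assume there are constants L, a_1, a_2 > 0 such that sup_{z∈Ω_ε}|g(z)| ≤ L and sup_{t∈[-1,1]}|g(t)| ≤ a_1·h_m(a_2·ε). Then, with a_3 := max{a_1, L} and a_4 := e·C·a_2, one has sup_{z∈Ω_{ε/2}}|g(z)| ≤ a_3·h_n(a_4·ε). -/

import Mathlib

open Set Filter Topology Metric
open scoped ENNReal NNReal Topology

noncomputable section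

namespace JorisPaper

/-- The sequence `m` with `m_k = M_k / k!`. -/
def lc (M : ℕ → ℝ) (k : ℕ) : ℝ := M k / (Nat.factorial k : ℝ)

/-- A weight sequence: positive, log-convex, `M_0 = 1 ≤ M_1`, `M_k^{1/k} → ∞`. -/
structure IsWeightSeq (M : ℕ → ℝ) : Prop where
  pos : ∀ k, 0 < M k
  first : M 0 = 1
  one_le : 1 ≤ M 1
  logconvex : ∀ k, 1 ≤ k → M k ^ 2 ≤ M (k - 1) * M (k + 1)
  root : Filter.Tendsto (fun k : ℕ => M k ^ ((1 : ℝ) / (k : ℝ))) atTop atTop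

/-- `m_k^{1/k} → ∞`. -/
def RootsTendsto (m : ℕ → ℝ) : Prop :=
  Filter.Tendsto (fun k : ℕ => m k ^ ((1 : ℝ) / (k : ℝ))) atTop atTop

/-- `h_m(t) = inf_k m_k t^k` for `t > 0`, and `0` for `t ≤ 0`. -/
def hfn (m : ℕ → ℝ) (t : ℝ) : ℝ := if t ≤ 0 then 0 else ⨅ k : ℕ, m k * t ^ k

/-- `Γ̄_m(t) = min {k | h_m(t) = m_k t^k}`. -/
def GammaUpper (m : ℕ → ℝ) (t : ℝ) : ℕ := sInf {k : ℕ | hfn m t = m k * t ^ k}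

/-- `Γ̲_m(t) = min {k | m_{k+1}/m_k ≥ 1/t}`. -/
def GammaLower (m : ℕ → ℝ) (t : ℝ) : ℕ := sInf {k : ℕ | 1 / t ≤ m (k + 1) / m k}

/-- `mg(M,N) = sup_{j+k ≥ 1} (M_{j+k}/(N_j N_k))^{1/(j+k)}`, as an extended real. -/
def mg (M N : ℕ → ℝ) : ℝ≥0∞ :=
  ⨆ (j : ℕ) (k : ℕ) (_ : 1 ≤ j + k),
    ENNReal.ofReal ((M (j + k) / (N j * N k)) ^ (((j : ℝ) + (k : ℝ))⁻¹))

/-- A weight matrix: a totally ordered (pointwise) family of weight sequences. -/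
structure IsWeightMatrix (W : Set (ℕ → ℝ)) : Prop where
  weight : ∀ M ∈ W, IsWeightSeq M
  ordered : ∀ M ∈ W, ∀ N ∈ W, (∀ k, M k ≤ N k) ∨ (∀ k, N k ≤ M k)

/-- R-admissible weight matrix. -/
structure RAdmissible (W : Set (ℕ → ℝ)) : Prop where
  matrix : IsWeightMatrix W
  roots : ∀ M ∈ W, RootsTendsto (lc M)
  gamma : ∀ M ∈ W, ∃ N ∈ W, ∃ C : ℝ, 1 ≤ C ∧
    ∀ t : ℝ, 0 < t → GammaUpper (lc N) (C * t) ≤ GammaLower (lc M) t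
  mgrowth : ∀ M ∈ W, ∃ N ∈ W, mg M N < ⊤

/-- B-admissible weight matrix. -/
structure BAdmissible (W : Set (ℕ → ℝ)) : Prop where
  matrix : IsWeightMatrix W
  roots : ∀ M ∈ W, RootsTendsto (lc M)
  gamma : ∀ M ∈ W, ∃ N ∈ W, ∃ C : ℝ, 1 ≤ C ∧
    ∀ t : ℝ, 0 < t → GammaUpper (lc M) (C * t) ≤ GammaLower (lc N) t
  mgrowth : ∀ M ∈ W, ∃ N ∈ W, mg N M < ⊤

/-- `‖f‖^M_{K,ρ} < ∞` (derivatives taken within `U`). -/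
def SeqBoundedOn {E F : Type*} [NormedAddCommGroup E] [NormedSpace ℝ E]
    [NormedAddCommGroup F] [NormedSpace ℝ F]
    (M : ℕ → ℝ) (ρ : ℝ) (f : E → F) (U K : Set E) : Prop :=
  ∃ C : ℝ, ∀ x ∈ K, ∀ k : ℕ, ‖iteratedFDerivWithin ℝ k f U x‖ ≤ C * ρ ^ k * M k

/-- `f ∈ B^M_ρ(V)`: smooth on `V` with global bounds `‖f‖^M_{V,ρ} < ∞`. -/
def GlobalClass {E F : Type*} [NormedAddCommGroup E] [NormedSpace ℝ E]
    [NormedAddCommGroup F] [NormedSpace ℝ F]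
    (M : ℕ → ℝ) (ρ : ℝ) (f : E → F) (V : Set E) : Prop :=
  ContDiffOn ℝ (⊤ : ℕ∞) f V ∧ SeqBoundedOn M ρ f V V

/-- The Roumieu class `E^{{W}}(U)`. -/
def Roumieu {E F : Type*} [NormedAddCommGroup E] [NormedSpace ℝ E]
    [NormedAddCommGroup F] [NormedSpace ℝ F]
    (W : Set (ℕ → ℝ)) (U : Set E) (f : E → F) : Prop :=
  ContDiffOn ℝ (⊤ : ℕ∞) f U ∧
    ∀ K ⊆ U, IsCompact K → ∃ M ∈ W, ∃ ρ : ℝ, 0 < ρ ∧ SeqBoundedOn M ρ f U K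

/-- The Beurling class `E^{(W)}(U)`. -/
def Beurling {E F : Type*} [NormedAddCommGroup E] [NormedSpace ℝ E]
    [NormedAddCommGroup F] [NormedSpace ℝ F]
    (W : Set (ℕ → ℝ)) (U : Set E) (f : E → F) : Prop :=
  ContDiffOn ℝ (⊤ : ℕ∞) f U ∧
    ∀ K ⊆ U, IsCompact K → ∀ M ∈ W, ∀ ρ : ℝ, 0 < ρ → SeqBoundedOn M ρ f U K

/-- The open ellipse `Ω_ε` with vertices `±cosh ε` and co-vertices `±i sinh ε`. -/
def Omega (ε : ℝ) : Set ℂ :=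
  {z : ℂ | (z.re / Real.cosh ε) ^ 2 + (z.im / Real.sinh ε) ^ 2 < 1}

/-- `V_U = ⋃_{x ∈ U} (x + 𝔹)`. -/
def VU {E : Type*} [NormedAddCommGroup E] [NormedSpace ℝ E] (U : Set E) : Set E :=
  ⋃ x ∈ U, Metric.closedBall x 1

/-- A weight function in the sense of Braun–Meise–Taylor. -/
structure IsWeightFunction (ω : ℝ → ℝ) : Prop where
  cont : ContinuousOn ω (Ici 0)
  mono : MonotoneOn ω (Ici 0)
  nonneg : ∀ t, 0 ≤ t → 0 ≤ ω t
  bigO : (fun t => ω (2 * t)) =O[atTop] ω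
  littleO : ω =o[atTop] (fun t => t)
  logLittleO : Real.log =o[atTop] ω
  convex : ConvexOn ℝ (Ici 0) (fun t => ω (Real.exp t))

/-- The Young conjugate `φ*_ω(s) = sup_{t ≥ 0} (s t - ω(e^t))`. -/
def youngConj (ω : ℝ → ℝ) (s : ℝ) : ℝ :=
  sSup {y : ℝ | ∃ t : ℝ, 0 ≤ t ∧ y = s * t - ω (Real.exp t)}

/-- The Roumieu class `E^{{ω}}(U)` for a weight function `ω`. -/
def RoumieuW {E F : Type*} [NormedAddCommGroup E] [NormedSpace ℝ E]
    [NormedAddCommGroup F] [NormedSpace ℝ F]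
    (ω : ℝ → ℝ) (U : Set E) (f : E → F) : Prop :=
  ContDiffOn ℝ (⊤ : ℕ∞) f U ∧
    ∀ K ⊆ U, IsCompact K → ∃ C : ℝ, 0 < C ∧ ∃ ρ : ℝ, 0 < ρ ∧
      ∀ x ∈ K, ∀ k : ℕ, ‖iteratedFDerivWithin ℝ k f U x‖ ≤
        C * Real.exp ((1 / ρ) * youngConj ω (ρ * k))

/-- The Beurling class `E^{(ω)}(U)` for a weight function `ω`. -/
def BeurlingW {E F : Type*} [NormedAddCommGroup E] [NormedSpace ℝ E]
    [NormedAddCommGroup F] [NormedSpace ℝ F]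
    (ω : ℝ → ℝ) (U : Set E) (f : E → F) : Prop :=
  ContDiffOn ℝ (⊤ : ℕ∞) f U ∧
    ∀ K ⊆ U, IsCompact K → ∀ ρ : ℝ, 0 < ρ → ∃ C : ℝ, 0 < C ∧
      ∀ x ∈ K, ∀ k : ℕ, ‖iteratedFDerivWithin ℝ k f U x‖ ≤
        C * Real.exp ((1 / ρ) * youngConj ω (ρ * k))

lemma cosh_re (w : ℂ) : (Complex.cosh w).re = Real.cosh w.re * Real.cos w.im := by
  conv_lhs => rw [← Complex.re_add_im w, Complex.cosh_add, Complex.cosh_mul_I, Complex.sinh_mul_I,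
    ← Complex.ofReal_cosh, ← Complex.ofReal_cos, ← Complex.ofReal_sinh, ← Complex.ofReal_sin]
  simp [-Complex.ofReal_cosh, -Complex.ofReal_cos, -Complex.ofReal_sinh, -Complex.ofReal_sin]

lemma cosh_im (w : ℂ) : (Complex.cosh w).im = Real.sinh w.re * Real.sin w.im := by
  conv_lhs => rw [← Complex.re_add_im w, Complex.cosh_add, Complex.cosh_mul_I, Complex.sinh_mul_I,
    ← Complex.ofReal_cosh, ← Complex.ofReal_cos, ← Complex.ofReal_sinh, ← Complex.ofReal_sin]
  simp [-Complex.ofReal_cosh, -Complex.ofReal_cos, -Complex.ofReal_sinh, -Complex.ofReal_sin]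

lemma cosh_mem_Omega_iff {δ : ℝ} (hδ : 0 < δ) {w : ℂ} (hw : 0 ≤ w.re) :
    Complex.cosh w ∈ Omega δ ↔ w.re < δ := by
  have hc := Real.cosh_pos δ
  have hs : 0 < Real.sinh δ := Real.sinh_pos_iff.2 hδ
  have hsc := Real.sin_sq_add_cos_sq w.im
  have hw' : 0 ≤ Real.sinh w.re := Real.sinh_nonneg_iff.2 hw
  rw [Omega, mem_ofPred_eq, cosh_re, cosh_im]
  have hrw : (Real.cosh w.re * Real.cos w.im / Real.cosh δ) ^ 2 +
      (Real.sinh w.re * Real.sin w.im / Real.sinh δ) ^ 2 =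
      (Real.cosh w.re / Real.cosh δ) ^ 2 * Real.cos w.im ^ 2 +
      (Real.sinh w.re / Real.sinh δ) ^ 2 * Real.sin w.im ^ 2 := by ring
  rw [hrw]
  constructor
  · contrapose!
    intro h
    have h1 : 1 ≤ (Real.cosh w.re / Real.cosh δ) ^ 2 := by
      apply one_le_pow₀
      rw [one_le_div hc, Real.cosh_le_cosh, abs_of_pos hδ, abs_of_nonneg hw]
      exact h
    have h2 : 1 ≤ (Real.sinh w.re / Real.sinh δ) ^ 2 := by
      apply one_le_pow₀
      rw [one_le_div hs]
      exact Real.sinh_le_sinh.2 h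
    nlinarith [sq_nonneg (Real.cos w.im), sq_nonneg (Real.sin w.im)]
  · intro h
    have h1 : (Real.cosh w.re / Real.cosh δ) ^ 2 < 1 := by
      apply pow_lt_one₀ (by positivity) _ two_ne_zero
      rw [div_lt_one hc, Real.cosh_lt_cosh, abs_of_pos hδ, abs_of_nonneg hw]
      exact h
    have h2 : (Real.sinh w.re / Real.sinh δ) ^ 2 < 1 := by
      apply pow_lt_one₀ (by positivity) _ two_ne_zero
      rw [div_lt_one hs]
      exact Real.sinh_lt_sinh.2 h
    rcases (sq_nonneg (Real.sin w.im)).eq_or_lt with h0 | h0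
    · rw [← h0] at hsc ⊢
      nlinarith
    · nlinarith [sq_nonneg (Real.cos w.im)]

lemma exists_cosh_eq (z : ℂ) : ∃ w : ℂ, 0 ≤ w.re ∧ Complex.cosh w = z := by
  obtain ⟨v, rfl⟩ := Complex.cos_surjective z
  rcases le_total 0 (v * Complex.I).re with h | h
  · exact ⟨v * Complex.I, h, Complex.cosh_mul_I v⟩
  · exact ⟨-(v * Complex.I), by rw [Complex.neg_re]; linarith,
      by rw [Complex.cosh_neg, Complex.cosh_mul_I]⟩

/-- Three lines theorem on the confocal ellipse, parametrized by `cosh` on a vertical strip. -/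
lemma norm_cosh_le_interp {E : Type*} [NormedAddCommGroup E] [NormedSpace ℂ E]
    {ε : ℝ} (hε : 0 < ε) {g : ℂ → E}
    (hghol : DifferentiableOn ℂ g (Omega ε)) (hgcont : ContinuousOn g (closure (Omega ε)))
    {L A : ℝ} (hbdd : ∀ z ∈ Omega ε, ‖g z‖ ≤ L)
    (hseg : ∀ t ∈ Icc (-1 : ℝ) 1, ‖g (t : ℂ)‖ ≤ A)
    {w : ℂ} (hw0 : 0 ≤ w.re) (hwε : w.re ≤ ε) :
    ‖g (Complex.cosh w)‖ ≤ A ^ (1 - w.re / ε) * L ^ (w.re / ε) := by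
  have hcl : closure (Complex.HadamardThreeLines.verticalStrip 0 ε) =
      Complex.HadamardThreeLines.verticalClosedStrip 0 ε := by
    rw [Complex.HadamardThreeLines.verticalStrip, Complex.closure_preimage_re,
      closure_Ioo hε.ne, Complex.HadamardThreeLines.verticalClosedStrip]
  have hmaps : MapsTo Complex.cosh (Complex.HadamardThreeLines.verticalStrip 0 ε) (Omega ε) :=
    fun v hv ↦ (cosh_mem_Omega_iff hε hv.1.le).2 hv.2
  have hmapscl : MapsTo Complex.cosh (closure (Complex.HadamardThreeLines.verticalStrip 0 ε))
      (closure (Omega ε)) := hmaps.closure Complex.continuous_cosh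
  have hbddcl : ∀ z ∈ closure (Omega ε), ‖g z‖ ≤ L := fun z hz ↦
    le_on_closure hbdd hgcont.norm continuousOn_const hz
  have key := Complex.HadamardThreeLines.norm_le_interp_of_mem_verticalClosedStrip'
    (f := g ∘ Complex.cosh) (z := w) (a := A) (b := L) hε ⟨hw0, hwε⟩
    ⟨hghol.comp Complex.differentiable_cosh.differentiableOn hmaps,
      hgcont.comp Complex.continuous_cosh.continuousOn hmapscl⟩
    ⟨L, by
      rintro _ ⟨v, hv, rfl⟩
      exact hbddcl _ (hmapscl (hcl ▸ hv))⟩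
    (fun v hv ↦ by
      have hv : v.re = 0 := hv
      have : Complex.cosh v = (Real.cos v.im : ℂ) := by
        apply Complex.ext <;> simp only [cosh_re, cosh_im, Complex.ofReal_re, Complex.ofReal_im, hv]
          <;> simp
      rw [Function.comp_apply, this]
      exact hseg _ (Real.cos_mem_Icc _))
    (fun v hv ↦ by
      have hv : v.re = ε := hv
      exact hbddcl _ (hmapscl (hcl ▸ ⟨hv ▸ hε.le, hv.le⟩)))
  simpa using key

lemma hfn_nonneg {m : ℕ → ℝ} (hm : ∀ k, 0 ≤ m k) (t : ℝ) : 0 ≤ hfn m t := by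
  unfold hfn
  split_ifs with h
  · exact le_rfl
  · exact Real.iInf_nonneg fun k ↦ mul_nonneg (hm k) (pow_nonneg (not_le.1 h).le k)

lemma hfn_le {m : ℕ → ℝ} (hm : ∀ k, 0 ≤ m k) {t : ℝ} (ht : 0 < t) (k : ℕ) :
    hfn m t ≤ m k * t ^ k := by
  rw [hfn, if_neg ht.not_ge]
  refine ciInf_le ⟨0, ?_⟩ k
  rintro _ ⟨j, rfl⟩
  exact mul_nonneg (hm j) (pow_nonneg ht.le j)

lemma rpow_le_mg_toReal {M N : ℕ → ℝ} (hmg : mg M N < ⊤) {j k : ℕ} (hjk : 1 ≤ j + k) :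
    (M (j + k) / (N j * N k)) ^ (((j : ℝ) + (k : ℝ))⁻¹) ≤ (mg M N).toReal := by
  refine (ENNReal.ofReal_le_iff_le_toReal hmg.ne).1 ?_
  exact le_iSup_of_le j (le_iSup_of_le k (le_iSup_of_le hjk le_rfl))

lemma mg_toReal_pos {M N : ℕ → ℝ} (hM : ∀ k, 0 < M k) (hN : ∀ k, 0 < N k) (hmg : mg M N < ⊤) :
    0 < (mg M N).toReal :=
  (Real.rpow_pos_of_pos (div_pos (hM _) (mul_pos (hN _) (hN _))) _).trans_le
    (rpow_le_mg_toReal hmg (j := 1) (k := 0) le_rfl)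

lemma le_mg_toReal_pow {M N : ℕ → ℝ} (hM : ∀ k, 0 < M k) (hN : ∀ k, 0 < N k)
    (hmg : mg M N < ⊤) {j k : ℕ} (hjk : 1 ≤ j + k) :
    M (j + k) ≤ (mg M N).toReal ^ (j + k) * (N j * N k) := by
  have hNN := mul_pos (hN j) (hN k)
  have h := rpow_le_mg_toReal hmg hjk
  rw [Real.rpow_inv_le_iff_of_pos (div_pos (hM _) hNN).le ENNReal.toReal_nonneg
    (by exact_mod_cast hjk), ← Nat.cast_add, Real.rpow_natCast, div_le_iff₀ hNN] at h
  exact h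

/-- Moderate growth turns a square root of `h_m` into a dilation of `h_n`. -/
lemma hfn_rpow_half_le {M N : ℕ → ℝ} (hM : ∀ k, 0 < M k) (hN : ∀ k, 0 < N k)
    (hM0 : M 0 = 1) (hN0 : N 0 = 1) (hmg : mg M N < ⊤) {t : ℝ} (ht : 0 < t) :
    hfn (lc M) t ^ (1 / 2 : ℝ) ≤ hfn (lc N) (Real.exp 1 * (mg M N).toReal * t) := by
  have hC := mg_toReal_pos hM hN hmg
  have hmpos : ∀ k, 0 ≤ lc M k := fun k ↦ (div_pos (hM k) (by positivity)).le
  have hpos : 0 < Real.exp 1 * (mg M N).toReal * t := by positivity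
  conv_rhs => rw [hfn, if_neg hpos.not_ge]
  refine le_ciInf fun k ↦ ?_
  set C := (mg M N).toReal
  have hn : 0 ≤ lc N k := (div_pos (hN k) (by positivity)).le
  rw [← Real.sqrt_eq_rpow]
  have hMk : M (k + k) ≤ C ^ (k + k) * (N k * N k) := by
    rcases Nat.eq_zero_or_pos k with rfl | hk
    · simp [hM0, hN0]
    · exact le_mg_toReal_pow hM hN hmg (by omega)
  have hfac : (Nat.factorial k * Nat.factorial k : ℝ) ≤ Nat.factorial (k + k) := by
    exact_mod_cast Nat.le_of_dvd (Nat.factorial_pos _)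
      (Nat.factorial_mul_factorial_dvd_factorial_add k k)
  have hlc : lc M (k + k) ≤ C ^ (k + k) * (lc N k * lc N k) := by
    have hNk := hN k
    calc lc M (k + k) ≤ C ^ (k + k) * (N k * N k) / (Nat.factorial k * Nat.factorial k) := by
          unfold lc
          gcongr
      _ = C ^ (k + k) * (lc N k * lc N k) := by
          unfold lc
          field_simp
  have hsq : hfn (lc M) t ≤ (lc N k * (C * t) ^ k) ^ 2 :=
    calc hfn (lc M) t ≤ lc M (k + k) * t ^ (k + k) := hfn_le hmpos ht _
      _ ≤ C ^ (k + k) * (lc N k * lc N k) * t ^ (k + k) := by gcongr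
      _ = (lc N k * (C * t) ^ k) ^ 2 := by ring
  calc √(hfn (lc M) t) ≤ lc N k * (C * t) ^ k := Real.sqrt_le_iff.2 ⟨by positivity, hsq⟩
    _ ≤ lc N k * (Real.exp 1 * C * t) ^ k := by
        gcongr
        exact le_mul_of_one_le_left hC.le (Real.one_le_exp zero_le_one)

/-- Hadamard three lines estimate transferring bounds on `[-1,1]` to `Ω_{ε/2}`. -/
theorem statement8 (M N : ℕ → ℝ) (hM : IsWeightSeq M) (hN : IsWeightSeq N)
    (hm : RootsTendsto (lc M)) (hn : RootsTendsto (lc N)) (hmg : mg M N < ⊤)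
    (ε : ℝ) (hε : 0 < ε) (g : ℂ → ℂ)
    (hghol : DifferentiableOn ℂ g (Omega ε))
    (hgcont : ContinuousOn g (closure (Omega ε)))
    (L a1 a2 : ℝ) (hL : 0 < L) (ha1 : 0 < a1) (ha2 : 0 < a2)
    (hbdd : ∀ z ∈ Omega ε, ‖g z‖ ≤ L)
    (hseg : ∀ t ∈ Icc (-1 : ℝ) 1, ‖g (t : ℂ)‖ ≤ a1 * hfn (lc M) (a2 * ε)) :
    ∀ z ∈ Omega (ε / 2),
      ‖g z‖ ≤ max a1 L * hfn (lc N) (Real.exp 1 * (mg M N).toReal * a2 * ε) := by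
  intro z hz
  obtain ⟨w, hw0, rfl⟩ := exists_cosh_eq z
  have hw : w.re < ε / 2 := (cosh_mem_Omega_iff (half_pos hε) hw0).1 hz
  have hmpos : ∀ k, 0 ≤ lc M k := fun k ↦ (div_pos (hM.pos k) (by positivity)).le
  have ht : 0 < a2 * ε := mul_pos ha2 hε
  set h := hfn (lc M) (a2 * ε)
  have hh0 : 0 ≤ h := hfn_nonneg hmpos _
  have hh1 : h ≤ 1 := by simpa [lc, hM.first] using hfn_le hmpos ht 0
  set s := w.re / ε
  have hs0 : 0 ≤ s := by positivity
  have hs : s ≤ 1 / 2 := by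
    rw [div_le_iff₀ hε]
    linarith
  have ha3 : 0 < max a1 L := lt_max_of_lt_left ha1
  calc ‖g (Complex.cosh w)‖ ≤ (a1 * h) ^ (1 - s) * L ^ s :=
        norm_cosh_le_interp hε hghol hgcont hbdd hseg hw0 (by linarith)
    _ ≤ (max a1 L * h) ^ (1 - s) * max a1 L ^ s := by
        gcongr
        · linarith
        · exact le_max_left _ _
        · exact le_max_right _ _
    _ = max a1 L * h ^ (1 - s) := by
        rw [Real.mul_rpow ha3.le hh0, mul_right_comm, ← Real.rpow_add ha3]
        simp
    _ ≤ max a1 L * h ^ (1 / 2 : ℝ) := by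
        gcongr ?_ * ?_
        exact Real.rpow_le_rpow_of_exponent_ge' hh0 hh1 (by norm_num) (by linarith)
    _ ≤ max a1 L * hfn (lc N) (Real.exp 1 * (mg M N).toReal * a2 * ε) := by
        rw [mul_assoc _ a2 ε]
        gcongr
        exact hfn_rpow_half_le hM.pos hN.pos hM.first hN.first hmg ht

end JorisPaper
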